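/- Fix m ≥ 1, constants 0 < c ≤ d, δ > 0 and R > 0. Then there exists a constant C = C(m, c, d, δ, R) such that for all n ≥ 1, all real observations y_0, y_1, …, y_n, all state sequences x ∈ {1,…,m}^n, and all parameters ψ = (θ, σ², A) and ψ′ = (θ′, σ′², A′) with ‖θ_i‖, ‖θ′_i‖ ≤ R, σ_i², σ′_i² ∈ [c,d], and a_{ij}, a′_{ij} ∈ [δ, 1]: |(1/n)·log p_ψ(y_1^n, x | y_0) − (1/n)·log p_{ψ′}(y_1^n, x | y_0)| ≤ C·( 1 + (1/n)·Σ_{k=0}^n y_k² )·‖ψ − ψ′‖, where the complete likelihood is p_ψ(y_1^n, x | y_0) = ∏_{k=1}^n a_{x_{k−1}x_k}·(2πσ_{x_k}²)^{−1/2}·exp( −(y_k − α_{x_k}y_{k−1} − b_{x_k})²/(2σ_{x_k}²) ) (with a fixed convention for the factor at k = 1, e.g. a_{x_0 x_1} replaced by 1). -/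

import Mathlib

open Real Finset

/-- The complete (joint) likelihood `p_ψ(y_1^n, x | y_0)` of the Gaussian linear AR process
with regime path `x`:
`∏_{k=1}^n a_{x_{k−1}x_k} (2πσ²_{x_k})^{−1/2} exp(−(y_k − α_{x_k}y_{k−1} − b_{x_k})²/(2σ²_{x_k}))`,
with the convention that the transition factor at `k = 1` is replaced by `1`. -/
noncomputable def armrCompLik {m : ℕ} (b a s2 : Fin m → ℝ) (A : Fin m → Fin m → ℝ)
    (y : ℕ → ℝ) (x : ℕ → Fin m) (n : ℕ) : ℝ :=
  ∏ k ∈ Finset.Icc 1 n,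
    (if k = 1 then (1 : ℝ) else A (x (k - 1)) (x k)) *
      ((Real.sqrt (2 * Real.pi * s2 (x k)))⁻¹ *
        Real.exp (-(y k - a (x k) * y (k - 1) - b (x k)) ^ 2 / (2 * s2 (x k))))

/-- Euclidean norm of the difference of the full parameter vectors
`ψ = (θ, σ², A)`, `ψ′ = (θ′, σ′², A′)`. -/
noncomputable def psiDist {m : ℕ} (b a s2 : Fin m → ℝ) (A : Fin m → Fin m → ℝ)
    (b' a' s2' : Fin m → ℝ) (A' : Fin m → Fin m → ℝ) : ℝ :=
  Real.sqrt ((∑ i, ((b i - b' i) ^ 2 + (a i - a' i) ^ 2 + (s2 i - s2' i) ^ 2)) +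
    ∑ i, ∑ j, (A i j - A' i j) ^ 2)

lemma aux_log {e p q : ℝ} (he : 0 < e) (hp : e ≤ p) (hq : e ≤ q) :
    |Real.log p - Real.log q| ≤ |p - q| / e := by
  have key : ∀ p q : ℝ, e ≤ p → e ≤ q → Real.log p - Real.log q ≤ |p - q| / e := by
    intro p q hp hq
    have hp0 : 0 < p := lt_of_lt_of_le he hp
    have hq0 : 0 < q := lt_of_lt_of_le he hq
    rw [← Real.log_div hp0.ne' hq0.ne']
    have h1 := Real.log_le_sub_one_of_pos (div_pos hp0 hq0)
    have h2 : p / q - 1 = (p - q) / q := by field_simp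
    calc Real.log (p / q) ≤ (p - q) / q := by linarith
      _ ≤ |p - q| / q := by gcongr; exact le_abs_self _
      _ ≤ |p - q| / e := by gcongr
  rw [abs_le]
  constructor
  · have := key q p hq hp
    rw [abs_sub_comm] at this
    linarith
  · exact key p q hp hq

lemma aux_quad {c R D w z b a s b' a' s' : ℝ} (hc : 0 < c) (hR : 0 < R)
    (hb : |b| ≤ R) (ha : |a| ≤ R) (hb' : |b'| ≤ R) (ha' : |a'| ≤ R)
    (hs : c ≤ s) (hs' : c ≤ s') (hD : 0 ≤ D)
    (h1 : |b - b'| ≤ D) (h2 : |a - a'| ≤ D) (h3 : |s - s'| ≤ D) :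
    |(w - a * z - b) ^ 2 / (2 * s) - (w - a' * z - b') ^ 2 / (2 * s')| ≤
      (3 * (1 + R) / c + 3 * (1 + R) ^ 2 / (2 * c ^ 2)) * (1 + w ^ 2 + z ^ 2) * D := by
  have hs0 : 0 < s := lt_of_lt_of_le hc hs
  have hs0' : 0 < s' := lt_of_lt_of_le hc hs'
  have hu : ∀ a b : ℝ, |a| ≤ R → |b| ≤ R →
      |w - a * z - b| ≤ (1 + R) * (1 + |w| + |z|) := by
    intro a b ha hb
    have e1 : |w - a * z - b| ≤ |w| + |a| * |z| + |b| := by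
      rw [← abs_mul]
      exact (abs_sub _ _).trans (by gcongr; exact abs_sub _ _)
    have e2 : |a| * |z| ≤ R * |z| := by gcongr
    nlinarith [abs_nonneg w, abs_nonneg z, mul_nonneg hR.le (abs_nonneg w)]
  have hT : (1 + |w| + |z|) ^ 2 ≤ 3 * (1 + w ^ 2 + z ^ 2) := by
    nlinarith [sq_abs w, sq_abs z, sq_nonneg (|w| - 1), sq_nonneg (|z| - 1),
      sq_nonneg (|w| - |z|)]
  have hu1 := hu a b ha hb
  have hu2 := hu a' b' ha' hb'
  have hd : |(w - a * z - b) - (w - a' * z - b')| ≤ D * (1 + |w| + |z|) := by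
    have : (w - a * z - b) - (w - a' * z - b') = -((a - a') * z + (b - b')) := by ring
    rw [this, abs_neg]
    have e1 := abs_add_le ((a - a') * z) (b - b')
    rw [abs_mul] at e1
    have e2 : |a - a'| * |z| ≤ D * |z| := by gcongr
    nlinarith [mul_nonneg hD (abs_nonneg w)]
  generalize w - a * z - b = u at *
  generalize w - a' * z - b' = v at *
  have hT0 : 0 ≤ 1 + |w| + |z| := by positivity
  generalize 1 + |w| + |z| = T at *
  generalize 1 + w ^ 2 + z ^ 2 = Q at *
  have hdec : u ^ 2 / (2 * s) - v ^ 2 / (2 * s') =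
      (u - v) * (u + v) / (2 * s) - v ^ 2 * (s - s') / (2 * (s * s')) := by
    field_simp
    ring
  have p1 : |(u - v) * (u + v) / (2 * s)| ≤ (D * T) * (2 * ((1 + R) * T)) / (2 * c) := by
    rw [abs_div, abs_mul, abs_of_pos (by positivity : 0 < 2 * s)]
    have : |u + v| ≤ 2 * ((1 + R) * T) := (abs_add_le _ _).trans (by linarith)
    gcongr
  have p2 : |v ^ 2 * (s - s') / (2 * (s * s'))| ≤ ((1 + R) * T) ^ 2 * D / (2 * (c * c)) := by
    rw [abs_div, abs_mul, abs_pow, abs_of_pos (by positivity : 0 < 2 * (s * s'))]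
    gcongr
  rw [hdec]
  calc _ ≤ (D * T) * (2 * ((1 + R) * T)) / (2 * c) + ((1 + R) * T) ^ 2 * D / (2 * (c * c)) :=
        (abs_sub _ _).trans (add_le_add p1 p2)
    _ = ((1 + R) / c + (1 + R) ^ 2 / (2 * c ^ 2)) * D * T ^ 2 := by
        field_simp
    _ ≤ ((1 + R) / c + (1 + R) ^ 2 / (2 * c ^ 2)) * D * (3 * Q) := by gcongr
    _ = _ := by ring

lemma aux_term {t s u : ℝ} (ht : 0 < t) (hs : 0 < s) :
    Real.log (t * ((Real.sqrt (2 * Real.pi * s))⁻¹ * Real.exp (-u ^ 2 / (2 * s)))) =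
      Real.log t - (Real.log (2 * Real.pi) + Real.log s) / 2 - u ^ 2 / (2 * s) := by
  have hp := Real.pi_pos
  have h1 : 0 < Real.sqrt (2 * Real.pi * s) := by positivity
  rw [Real.log_mul ht.ne' (by positivity), Real.log_mul (by positivity) (by positivity),
    Real.log_inv, Real.log_sqrt (by positivity), Real.log_exp,
    Real.log_mul (by positivity) hs.ne']
  ring

lemma aux_loglik {m : ℕ} (b a s2 : Fin m → ℝ) (A : Fin m → Fin m → ℝ)
    (y : ℕ → ℝ) (x : ℕ → Fin m) (n : ℕ) (hs : ∀ i, 0 < s2 i) (hA : ∀ i j, 0 < A i j) :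
    Real.log (armrCompLik b a s2 A y x n) = ∑ k ∈ Finset.Icc 1 n,
      (Real.log (if k = 1 then (1 : ℝ) else A (x (k - 1)) (x k)) -
        (Real.log (2 * Real.pi) + Real.log (s2 (x k))) / 2 -
        (y k - a (x k) * y (k - 1) - b (x k)) ^ 2 / (2 * s2 (x k))) := by
  have ht : ∀ k, 0 < (if k = 1 then (1 : ℝ) else A (x (k - 1)) (x k)) := by
    intro k
    split_ifs
    · exact one_pos
    · exact hA _ _
  unfold armrCompLik
  rw [Real.log_prod]
  · refine Finset.sum_congr rfl fun k _ => aux_term (ht k) (hs _)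
  · intro k _
    have h1 := ht k
    have h2 := hs (x k)
    have hp := Real.pi_pos
    have h3 : 0 < Real.sqrt (2 * Real.pi * s2 (x k)) := by positivity
    exact (mul_pos h1 (mul_pos (inv_pos.2 h3) (Real.exp_pos _))).ne'

lemma aux_dist {m : ℕ} (b a s2 : Fin m → ℝ) (A : Fin m → Fin m → ℝ)
    (b' a' s2' : Fin m → ℝ) (A' : Fin m → Fin m → ℝ) :
    (∀ i, |b i - b' i| ≤ psiDist b a s2 A b' a' s2' A') ∧
    (∀ i, |a i - a' i| ≤ psiDist b a s2 A b' a' s2' A') ∧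
    (∀ i, |s2 i - s2' i| ≤ psiDist b a s2 A b' a' s2' A') ∧
    (∀ i j, |A i j - A' i j| ≤ psiDist b a s2 A b' a' s2' A') := by
  have hN : 0 ≤ ∑ i, ∑ j, (A i j - A' i j) ^ 2 := by positivity
  have hM : 0 ≤ ∑ i, ((b i - b' i) ^ 2 + (a i - a' i) ^ 2 + (s2 i - s2' i) ^ 2) := by
    positivity
  have hi : ∀ i, (b i - b' i) ^ 2 + (a i - a' i) ^ 2 + (s2 i - s2' i) ^ 2 ≤
      ∑ i, ((b i - b' i) ^ 2 + (a i - a' i) ^ 2 + (s2 i - s2' i) ^ 2) := fun i =>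
    Finset.single_le_sum
      (f := fun i => (b i - b' i) ^ 2 + (a i - a' i) ^ 2 + (s2 i - s2' i) ^ 2)
      (fun i _ => by positivity) (Finset.mem_univ i)
  have hj : ∀ i j, (A i j - A' i j) ^ 2 ≤ ∑ i, ∑ j, (A i j - A' i j) ^ 2 := fun i j =>
    (Finset.single_le_sum (f := fun j => (A i j - A' i j) ^ 2)
      (fun i _ => by positivity) (Finset.mem_univ j)).trans
    (Finset.single_le_sum (f := fun i => ∑ j, (A i j - A' i j) ^ 2)
      (fun i _ => by positivity) (Finset.mem_univ i))
  unfold psiDist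
  refine ⟨fun i => ?_, fun i => ?_, fun i => ?_, fun i j => ?_⟩
  · apply Real.abs_le_sqrt
    nlinarith [hi i, sq_nonneg (a i - a' i), sq_nonneg (s2 i - s2' i)]
  · apply Real.abs_le_sqrt
    nlinarith [hi i, sq_nonneg (b i - b' i), sq_nonneg (s2 i - s2' i)]
  · apply Real.abs_le_sqrt
    nlinarith [hi i, sq_nonneg (a i - a' i), sq_nonneg (b i - b' i)]
  · apply Real.abs_le_sqrt
    linarith [hj i j]

lemma aux_bd {b a R : ℝ} (h : Real.sqrt (b ^ 2 + a ^ 2) ≤ R) : |b| ≤ R ∧ |a| ≤ R :=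
  ⟨(Real.abs_le_sqrt (by nlinarith [sq_nonneg a])).trans h,
    (Real.abs_le_sqrt (by nlinarith [sq_nonneg b])).trans h⟩

lemma aux_sum (y : ℕ → ℝ) (n : ℕ) :
    ∑ k ∈ Finset.Icc 1 n, (1 + y k ^ 2 + y (k - 1) ^ 2) ≤
      n + 2 * ∑ k ∈ Finset.range (n + 1), y k ^ 2 := by
  have h : ∑ k ∈ Finset.Icc 1 n, (1 + y k ^ 2 + y (k - 1) ^ 2) =
      ∑ k ∈ Finset.range n, (1 + y (k + 1) ^ 2 + y k ^ 2) := by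
    clear * -
    induction n with
    | zero => simp
    | succ k ih =>
      rw [Finset.sum_Icc_succ_top (by omega), ih, Finset.sum_range_succ, Nat.add_sub_cancel]
  rw [h, Finset.sum_add_distrib, Finset.sum_add_distrib]
  have h1 := Finset.sum_range_succ (fun k => y k ^ 2) n
  have h2 := Finset.sum_range_succ' (fun k => y k ^ 2) n
  simp only [Finset.sum_const, Finset.card_range, nsmul_eq_mul, mul_one]
  nlinarith [sq_nonneg (y 0), sq_nonneg (y n)]

/-- Deterministic Lipschitz estimate for the normalized complete log-likelihood of the
AR-MR model: there is a constant `C = C(m,c,d,δ,R)` such that for all `n ≥ 1`, all data,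
all regime paths and all pairs of parameters with `‖θ_i‖,‖θ′_i‖ ≤ R`, `σ_i²,σ′_i² ∈ [c,d]`,
`a_{ij},a′_{ij} ∈ [δ,1]`,
`|(1/n)log p_ψ(y_1^n,x|y_0) − (1/n)log p_{ψ′}(y_1^n,x|y_0)|
  ≤ C (1 + (1/n)Σ_{k=0}^n y_k²) ‖ψ−ψ′‖`. -/
theorem stmt_15 (m : ℕ) (hm : 1 ≤ m) (c d δ R : ℝ)
    (hc : 0 < c) (hcd : c ≤ d) (hδ : 0 < δ) (hR : 0 < R) :
    ∃ C : ℝ, ∀ (n : ℕ), 1 ≤ n → ∀ (y : ℕ → ℝ) (x : ℕ → Fin m)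
      (b a s2 b' a' s2' : Fin m → ℝ) (A A' : Fin m → Fin m → ℝ),
      (∀ i, Real.sqrt ((b i) ^ 2 + (a i) ^ 2) ≤ R) →
      (∀ i, Real.sqrt ((b' i) ^ 2 + (a' i) ^ 2) ≤ R) →
      (∀ i, s2 i ∈ Set.Icc c d) → (∀ i, s2' i ∈ Set.Icc c d) →
      (∀ i j, A i j ∈ Set.Icc δ 1) → (∀ i j, A' i j ∈ Set.Icc δ 1) →
      |(1 / (n : ℝ)) * Real.log (armrCompLik b a s2 A y x n) -
          (1 / (n : ℝ)) * Real.log (armrCompLik b' a' s2' A' y x n)|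
        ≤ C * (1 + (1 / (n : ℝ)) * ∑ k ∈ Finset.range (n + 1), (y k) ^ 2) *
            psiDist b a s2 A b' a' s2' A' := by
  refine ⟨2 * (1 / δ + 1 / (2 * c) +
    (3 * (1 + R) / c + 3 * (1 + R) ^ 2 / (2 * c ^ 2))), ?_⟩
  intro n hn y x b a s2 b' a' s2' A A' hθ hθ' hs hs' hA hA'
  obtain ⟨d1, d2, d3, d4⟩ := aux_dist b a s2 A b' a' s2' A'
  have hD : 0 ≤ psiDist b a s2 A b' a' s2' A' := Real.sqrt_nonneg _
  rw [aux_loglik b a s2 A y x n (fun i => hc.trans_le (hs i).1)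
      (fun i j => hδ.trans_le (hA i j).1),
    aux_loglik b' a' s2' A' y x n (fun i => hc.trans_le (hs' i).1)
      (fun i j => hδ.trans_le (hA' i j).1), ← mul_sub, ← Finset.sum_sub_distrib]
  generalize psiDist b a s2 A b' a' s2' A' = D at *
  have hn0 : (0 : ℝ) < n := by exact_mod_cast hn
  set B := 3 * (1 + R) / c + 3 * (1 + R) ^ 2 / (2 * c ^ 2) with hB
  have hB0 : 0 ≤ B := by positivity
  set K := 1 / δ + 1 / (2 * c) + B with hK
  have hK0 : 0 ≤ K := by positivity
  have hterm : ∀ k ∈ Finset.Icc 1 n,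
      |(Real.log (if k = 1 then (1 : ℝ) else A (x (k - 1)) (x k)) -
        (Real.log (2 * Real.pi) + Real.log (s2 (x k))) / 2 -
        (y k - a (x k) * y (k - 1) - b (x k)) ^ 2 / (2 * s2 (x k))) -
      (Real.log (if k = 1 then (1 : ℝ) else A' (x (k - 1)) (x k)) -
        (Real.log (2 * Real.pi) + Real.log (s2' (x k))) / 2 -
        (y k - a' (x k) * y (k - 1) - b' (x k)) ^ 2 / (2 * s2' (x k)))| ≤
      K * D * (1 + y k ^ 2 + y (k - 1) ^ 2) := by
    intro k _
    have q1 : |Real.log (if k = 1 then (1 : ℝ) else A (x (k - 1)) (x k)) -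
        Real.log (if k = 1 then (1 : ℝ) else A' (x (k - 1)) (x k))| ≤ 1 / δ * D := by
      split_ifs
      · rw [sub_self, abs_zero]; positivity
      · refine (aux_log hδ (hA _ _).1 (hA' _ _).1).trans ?_
        rw [one_div_mul_eq_div]
        gcongr
        exact d4 _ _
    have q2 : |Real.log (s2 (x k)) - Real.log (s2' (x k))| ≤ 2 * (1 / (2 * c) * D) := by
      refine (aux_log hc (hs (x k)).1 (hs' (x k)).1).trans ?_
      have : 2 * (1 / (2 * c) * D) = D / c := by field_simp
      rw [this]
      gcongr
      exact d3 _
    have q3 := aux_quad (w := y k) (z := y (k - 1)) hc hR (aux_bd (hθ (x k))).1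
      (aux_bd (hθ (x k))).2 (aux_bd (hθ' (x k))).1 (aux_bd (hθ' (x k))).2
      (hs (x k)).1 (hs' (x k)).1 hD (d1 (x k)) (d2 (x k)) (d3 (x k))
    rw [← hB] at q3
    have r1 : 0 ≤ (1 / δ + 1 / (2 * c)) * D * (y k ^ 2 + y (k - 1) ^ 2) := by positivity
    have r2 : K * D * (1 + y k ^ 2 + y (k - 1) ^ 2) =
        1 / δ * D + 1 / (2 * c) * D + B * (1 + y k ^ 2 + y (k - 1) ^ 2) * D +
        (1 / δ + 1 / (2 * c)) * D * (y k ^ 2 + y (k - 1) ^ 2) := by rw [hK]; ring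
    rw [r2]
    rw [abs_le] at *
    constructor <;> linarith [q1.1, q1.2, q2.1, q2.2, q3.1, q3.2]
  have hsum := (Finset.abs_sum_le_sum_abs _ _).trans (Finset.sum_le_sum hterm)
  rw [← Finset.mul_sum] at hsum
  have hS := aux_sum y n
  rw [abs_mul, abs_of_pos (by positivity : 0 < 1 / (n : ℝ))]
  calc _ ≤ 1 / (n : ℝ) * (K * D * (n + 2 * ∑ k ∈ Finset.range (n + 1), y k ^ 2)) := by
        gcongr
        exact hsum.trans (by gcongr)
    _ = K * D * (1 + 2 * (1 / (n : ℝ) * ∑ k ∈ Finset.range (n + 1), y k ^ 2)) := by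
        field_simp
    _ ≤ K * D * (2 * (1 + 1 / (n : ℝ) * ∑ k ∈ Finset.range (n + 1), y k ^ 2)) := by
        gcongr
        linarith
    _ = _ := by ring
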